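/- Let m,n ≥ 2 and let φ : M_{m,n}(ℂ) → {B ∈ M_N(ℂ) : Bᵀ = B} be a triple morphism from the rectangular m×n matrices to the symmetric N×N matrices. Then there exist a natural number k with k·(m+n) ≤ N and unitary matrices U, V ∈ M_N(ℂ) such that φ(A) = U · ((diag_k(A) ⊕ diag_k(Aᵀ)) ⊕ 0) · V for every A ∈ M_{m,n}(ℂ), where (diag_k(A) ⊕ diag_k(Aᵀ)) ⊕ 0 is the N×N matrix whose top-left corner is the block-diagonal matrix with diagonal blocks diag_k(A) and diag_k(Aᵀ) and which is zero elsewhere. -/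

import Mathlib

open Matrix

/-- The `N × M` matrix having the block-diagonal matrix `diag_k(A)` (built from `k`
copies of the `n × m` matrix `A`) as a block whose top-left corner sits at row `r`
and column `c`, and zeros elsewhere. -/
noncomputable def diagPadAt {n m : ℕ} (N M r c k : ℕ) (A : Matrix (Fin n) (Fin m) ℂ) :
    Matrix (Fin N) (Fin M) ℂ := Matrix.of fun i j =>
  if h : r ≤ (i : ℕ) ∧ c ≤ (j : ℕ) ∧ ((i : ℕ) - r) % n < n ∧ ((j : ℕ) - c) % m < m ∧
      (i : ℕ) - r < k * n ∧ (j : ℕ) - c < k * m ∧ ((i : ℕ) - r) / n = ((j : ℕ) - c) / m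
  then A ⟨((i : ℕ) - r) % n, h.2.2.1⟩ ⟨((j : ℕ) - c) % m, h.2.2.2.1⟩ else 0

/-- The subspace of symmetric complex `n × n` matrices. -/
noncomputable def symmSub (n : ℕ) : Submodule ℂ (Matrix (Fin n) (Fin n) ℂ) where
  carrier := {A | Aᵀ = A}
  add_mem' := by
    intro a b ha hb
    simp only [Set.mem_setOf_eq] at *
    rw [Matrix.transpose_add, ha, hb]
  zero_mem' := by simp
  smul_mem' := by
    intro c A hA
    simp only [Set.mem_setOf_eq] at *
    rw [Matrix.transpose_smul, hA]

/-- The images of the matrix units under a triple morphism on `m × n` matrices. -/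
structure IsGrid {ι κ R : Type*} [DecidableEq ι] [DecidableEq κ] [Ring R] [StarRing R]
    (u : ι → κ → R) : Prop where
  triple : ∀ i j k l p q, u i j * star (u k l) * u p q + u p q * star (u k l) * u i j =
    (if j = l ∧ k = p then u i q else 0) + (if q = l ∧ k = i then u p j else 0)

namespace IsGrid

variable {ι κ R : Type*} [DecidableEq ι] [DecidableEq κ] [Ring R] [StarRing R]
  {u : ι → κ → R}

theorem row_collinear (h : IsGrid u) (i : ι) {j l : κ} (hjl : j ≠ l) :
    u i l * star (u i l) * u i j + u i j * star (u i l) * u i l = u i j := by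
  simpa [hjl] using h.triple i l i l i j

theorem col_collinear (h : IsGrid u) {i k : ι} (hik : i ≠ k) (j : κ) :
    u k j * star (u k j) * u i j + u i j * star (u k j) * u k j = u i j := by
  simpa [hik.symm] using h.triple k j k j i j

theorem quadrangle (h : IsGrid u) {i k : ι} {j l : κ} (hik : i ≠ k) (hjl : j ≠ l) :
    u i l * star (u k l) * u k j + u k j * star (u k l) * u i l = u i j := by
  simpa [hik.symm, hjl] using h.triple i l k l k j

variable [IsAddTorsionFree R]

theorem mul_star_mul_self (h : IsGrid u) (i : ι) (j : κ) :
    u i j * star (u i j) * u i j = u i j := by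
  have := h.triple i j i j i j
  simp only [and_self, if_true, ← two_nsmul] at this
  exact nsmul_right_injective two_ne_zero this

theorem mul_star_mul_of_ne (h : IsGrid u) {i k : ι} (hik : i ≠ k) (j : κ) :
    u i j * star (u k j) * u i j = 0 := by
  have := h.triple i j k j i j
  simp only [hik.symm, and_false, if_false, ← two_nsmul] at this
  exact nsmul_right_injective two_ne_zero this

theorem mul_star_mul_of_ne_col (h : IsGrid u) (i : ι) {j l : κ} (hjl : j ≠ l) :
    u i j * star (u i l) * u i j = 0 := by
  have := h.triple i j i l i j
  simp only [hjl, false_and, if_false, ← two_nsmul] at this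
  exact nsmul_right_injective two_ne_zero this

theorem star_mul_self_mul (h : IsGrid u) (i : ι) (j : κ) :
    star (u i j) * (u i j * star (u i j)) = star (u i j) := by
  simpa [mul_assoc] using congrArg star (h.mul_star_mul_self i j)

theorem orthogonal_aux (h : IsGrid u) {i k : ι} {j l : κ} (hik : i ≠ k) (hjl : j ≠ l) :
    u i j * star (u i j) * u k l = 0 := by
  have h1 := h.triple i j i j k l
  simp only [hik, hjl.symm, and_false, false_and, if_false, add_zero] at h1
  have h2 : u i j * star (u i j) * u k l = - (u k l * star (u i j) * u i j) :=
    eq_neg_of_add_eq_zero_left h1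
  have h3 : u i j * star (u i j) * (u i j * star (u i j) * u k l) =
      u i j * star (u i j) * u k l := by
    rw [← mul_assoc, ← mul_assoc, h.mul_star_mul_self]
  have h4 : u k l * star (u i j) * u i j * (star (u i j) * u i j) =
      u k l * star (u i j) * u i j := by
    have := h.mul_star_mul_self i j
    rw [mul_assoc (u k l), mul_assoc (u k l), mul_assoc (star (u i j)), ← mul_assoc (u i j), this]
  have h5 : u i j * star (u i j) * u k l = u k l * star (u i j) * u i j := by
    calc _ = u i j * star (u i j) * (u i j * star (u i j) * u k l) := h3.symm
      _ = - (u i j * star (u i j) * u k l * (star (u i j) * u i j)) := by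
          conv_lhs => rw [h2]
          noncomm_ring
      _ = u k l * star (u i j) * u i j * (star (u i j) * u i j) := by rw [h2]; noncomm_ring
      _ = _ := h4
  rw [← h5, ← two_nsmul] at h1
  exact (nsmul_eq_zero_iff_right two_ne_zero).1 h1

theorem star_mul_eq_zero (h : IsGrid u) {i k : ι} {j l : κ} (hik : i ≠ k) (hjl : j ≠ l) :
    star (u i j) * u k l = 0 := by
  rw [← h.star_mul_self_mul, mul_assoc, h.orthogonal_aux hik hjl, mul_zero]

theorem mul_star_eq_zero (h : IsGrid u) {i k : ι} {j l : κ} (hik : i ≠ k) (hjl : j ≠ l) :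
    u i j * star (u k l) = 0 := by
  have h1 := h.triple k l k l i j
  simp only [hik.symm, hjl, and_false, false_and, if_false, add_zero,
    h.orthogonal_aux hik.symm hjl.symm, zero_add] at h1
  rw [← h.star_mul_self_mul, ← mul_assoc, ← mul_assoc, h1, zero_mul]

/-- The products `u i j * star (u k j)`, for `i ≠ k`, do not depend on the column. -/
theorem mul_star_column_indep (h : IsGrid u) {i k : ι} (hik : i ≠ k) (j l : κ) :
    u i j * star (u k j) = u i l * star (u k l) := by
  rcases eq_or_ne j l with rfl | hjl
  · rfl
  have h1 : u i j * star (u k j) = u i l * star (u k l) * u k j * star (u k j) := by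
    conv_lhs => rw [← h.quadrangle hik hjl]
    rw [add_mul, mul_assoc (u k j * _), h.mul_star_eq_zero hik hjl.symm, mul_zero, add_zero]
  have h2 : u k j * star (u k j) * u k l * star (u i l) = u k l * star (u i l) := by
    conv_rhs => rw [← h.row_collinear k hjl.symm]
    rw [add_mul, mul_assoc (u k l * _), h.mul_star_eq_zero hik.symm hjl, mul_zero, add_zero]
  rw [h1]
  simpa [mul_assoc] using congrArg star h2

theorem row_part_eq (h : IsGrid u) {i k : ι} {j l : κ} (hik : i ≠ k) (hjl : j ≠ l) :
    u i j * star (u k j) * u k j = u i l * star (u i l) * u i j := by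
  rw [h.mul_star_column_indep hik j l]
  conv_rhs => rw [← h.quadrangle hik hjl]
  rw [mul_add, ← mul_assoc, ← mul_assoc, h.mul_star_mul_self, mul_assoc (u i l) (star (u i l)),
    ← mul_assoc (star (u i l)), ← mul_assoc (star (u i l)),
    h.star_mul_eq_zero hik hjl.symm, zero_mul, zero_mul, mul_zero, add_zero]

theorem col_part_eq (h : IsGrid u) {i k : ι} {j l : κ} (hik : i ≠ k) (hjl : j ≠ l) :
    u k j * star (u k j) * u i j = u i j * star (u i l) * u i l := by
  have h1 := h.row_collinear i hjl
  have h2 := h.col_collinear hik j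
  rw [← h.row_part_eq hik hjl, add_comm] at h1
  exact add_right_cancel (h2.trans h1.symm)

theorem mul_star_mul_col_part (h : IsGrid u) {i k : ι} (hik : i ≠ k) (j : κ) :
    u i j * star (u k j) * (u i j * star (u i j) * u k j) = 0 := by
  rw [← mul_assoc, ← mul_assoc, h.mul_star_mul_of_ne hik, zero_mul, zero_mul]

theorem mul_star_mul_row_part (h : IsGrid u) {i k : ι} (hik : i ≠ k) (j : κ) :
    u i j * star (u k j) * (u k j * star (u i j) * u i j) = u i j * star (u k j) * u k j := by
  conv_rhs => enter [2]; rw [← h.col_collinear hik.symm j]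
  rw [mul_add, h.mul_star_mul_col_part hik, zero_add]

theorem mul_star_triple (h : IsGrid u) {i k : ι} (hik : i ≠ k) (j : κ) :
    u i j * star (u k j) * (u k j * star (u i j) * (u i j * star (u k j))) =
      u i j * star (u k j) := by
  rw [← mul_assoc (u k j * star (u i j)), ← mul_assoc, h.mul_star_mul_row_part hik, mul_assoc,
    mul_assoc, h.star_mul_self_mul]

variable (u) in
/-- The support projection at row `o` of the part of the grid that preserves products. -/
def proj (o o' : ι) (z : κ) : R := u o z * star (u o' z) * (u o' z * star (u o z))

theorem star_proj {ι κ R : Type*} [Ring R] [StarRing R] (u : ι → κ → R)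
    (o o' : ι) (z : κ) : star (proj u o o' z) = proj u o o' z := by
  simp [proj]

variable (u) in
/-- The column factor, moving row `o` to row `i`. -/
def colFactor (o o' : ι) (z : κ) (i : ι) : R :=
  if i = o then proj u o o' z else u i z * star (u o z)

variable (u) in
/-- The row factor: the part of `u o j` that preserves products. -/
def rowFactor (o o' : ι) (j : κ) : R := u o j * star (u o' j) * u o' j

theorem proj_eq [Nontrivial κ] (h : IsGrid u) {o o' i : ι} (ho : o ≠ o') (hi : o ≠ i) (z : κ) :
    proj u o o' z = u o z * star (u i z) * (u i z * star (u o z)) := by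
  obtain ⟨l, hl⟩ := exists_ne z
  rw [proj, ← mul_assoc, ← mul_assoc, h.row_part_eq ho hl.symm, h.row_part_eq hi hl.symm]

theorem proj_column_indep (h : IsGrid u) {o o' : ι} (ho : o ≠ o') (j z : κ) :
    proj u o o' j = proj u o o' z := by
  rw [proj, h.mul_star_column_indep ho j z, h.mul_star_column_indep ho.symm j z, proj]

theorem proj_mul_self (h : IsGrid u) {o o' : ι} (ho : o ≠ o') (z : κ) :
    proj u o o' z * proj u o o' z = proj u o o' z := by
  simp only [proj]
  rw [mul_assoc (u o z * _), h.mul_star_triple ho.symm]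

theorem colFactor_mul_proj [Nontrivial κ] (h : IsGrid u) {o o' : ι} (ho : o ≠ o') (z : κ) (i : ι) :
    colFactor u o o' z i * proj u o o' z = colFactor u o o' z i := by
  unfold colFactor
  split_ifs with hi
  · exact h.proj_mul_self ho z
  · rw [h.proj_eq ho (Ne.symm hi), h.mul_star_triple hi]

theorem mul_star_mul_mul_star_of_ne [Nontrivial κ] (h : IsGrid u) {i k p q : ι} (hkp : k ≠ p)
    (hpq : p ≠ q) (z : κ) : u i z * star (u k z) * (u p z * star (u q z)) = 0 := by
  obtain ⟨l, hl⟩ := exists_ne z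
  rw [h.mul_star_column_indep hpq z l, mul_assoc, ← mul_assoc (star (u k z)),
    h.star_mul_eq_zero hkp hl.symm, zero_mul, mul_zero]

theorem proj_mul_mul_star [Nontrivial κ] (h : IsGrid u) {o o' k : ι} (hk : k ≠ o)
    (z : κ) : proj u o o' z * (u k z * star (u o z)) = 0 := by
  rw [proj, mul_assoc, h.mul_star_mul_mul_star_of_ne hk.symm hk, mul_zero]

theorem star_colFactor_mul_colFactor [Nontrivial κ] (h : IsGrid u) {o o' : ι} (ho : o ≠ o')
    (z : κ) (i k : ι) : star (colFactor u o o' z i) * colFactor u o o' z k =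
      if i = k then proj u o o' z else 0 := by
  unfold colFactor
  by_cases hi : i = o <;> by_cases hk : k = o
  · simp [hi, hk, star_proj, h.proj_mul_self ho]
  · have : i ≠ k := by rintro rfl; exact hk hi
    simp [hi, hk, hi ▸ this, star_proj, h.proj_mul_mul_star hk]
  · have : i ≠ k := by rintro rfl; exact hi hk
    have h0 := congrArg star (h.proj_mul_mul_star (o' := o') hi z)
    rw [star_mul, star_proj, star_zero] at h0
    simp only [hk, hi, if_true, if_false, h0]
  · rcases eq_or_ne i k with rfl | hik
    · simp [hi, h.proj_eq ho (Ne.symm hi)]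
    · simp [hi, hk, hik, h.mul_star_mul_mul_star_of_ne hik hk]

theorem rowFactor_mul_star_rowFactor (h : IsGrid u) {o o' : ι} (ho : o ≠ o') (z j l : κ) :
    rowFactor u o o' j * star (rowFactor u o o' l) = if j = l then proj u o o' z else 0 := by
  split_ifs with hjl
  · subst hjl
    rw [h.proj_column_indep ho z j, proj, rowFactor]
    simp only [star_mul, star_star]
    rw [mul_assoc, mul_assoc, ← mul_assoc (star (u o' j)) (u o' j) (star (u o j)),
      ← mul_assoc (u o' j) _ (star (u o j)), ← mul_assoc (u o' j), h.mul_star_mul_self, mul_assoc]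
  · rw [rowFactor, rowFactor]
    simp only [star_mul, star_star]
    rw [h.mul_star_column_indep ho.symm l j, mul_assoc, ← mul_assoc (star (u o' l)),
      ← mul_assoc (u o' j), ← mul_assoc (u o' j), h.mul_star_mul_of_ne_col o' hjl,
      zero_mul, mul_zero]

theorem colFactor_mul_rowFactor [Nontrivial κ] (h : IsGrid u) {o o' : ι} (ho : o ≠ o')
    (z : κ) (i : ι) (j : κ) : ∃ k, i ≠ k ∧
      colFactor u o o' z i * rowFactor u o o' j = u i j * star (u k j) * u k j := by
  by_cases hi : i = o
  · subst hi
    refine ⟨o', ho, ?_⟩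
    rw [colFactor, if_pos rfl, h.proj_column_indep ho z j, proj, rowFactor, mul_assoc,
      h.mul_star_mul_row_part ho.symm, h.mul_star_mul_row_part ho]
  · refine ⟨o, hi, ?_⟩
    obtain ⟨l, hl⟩ := exists_ne j
    rw [colFactor, if_neg hi, rowFactor, h.row_part_eq ho hl.symm,
      ← h.row_part_eq (Ne.symm hi) hl.symm, h.mul_star_column_indep hi z j,
      h.mul_star_mul_row_part hi]

theorem star_colFactor_mul_col_part [Nontrivial κ] (h : IsGrid u) {o o' : ι} (ho : o ≠ o')
    (z : κ) (i : ι) (j : κ) :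
    star (colFactor u o o' z i) * (u o' j * star (u o' j) * u o j) = 0 := by
  by_cases hi : i = o
  · rw [colFactor, if_pos hi, star_proj, h.proj_column_indep ho z j, proj, mul_assoc,
      h.mul_star_mul_col_part ho.symm, mul_zero]
  · obtain ⟨l, hl⟩ := exists_ne j
    rw [colFactor, if_neg hi, star_mul, star_star, h.mul_star_column_indep (Ne.symm hi) z l,
      h.col_part_eq ho hl.symm, mul_assoc, ← mul_assoc (star (u i l)), ← mul_assoc (star (u i l)),
      h.star_mul_eq_zero hi hl, zero_mul, zero_mul, mul_zero]

end IsGrid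

theorem Matrix.exists_isometry_of_projection {ι : Type*} [Fintype ι] [DecidableEq ι]
    {P : Matrix ι ι ℂ} (hP : Pᴴ = P) (hPP : P * P = P) :
    ∃ (k : ℕ) (E : Matrix ι (Fin k) ℂ), Eᴴ * E = 1 ∧ E * Eᴴ = P := by
  obtain ⟨W, l, hW1, hspec⟩ : ∃ (W : Matrix ι ι ℂ) (l : ι → ℝ),
      Wᴴ * W = 1 ∧ P = W * diagonal (fun i => (l i : ℂ)) * Wᴴ := by
    have hA : P.IsHermitian := hP
    refine ⟨hA.eigenvectorUnitary.1, hA.eigenvalues,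
      Unitary.coe_star_mul_self hA.eigenvectorUnitary, ?_⟩
    conv_lhs => rw [hA.spectral_theorem, Unitary.conjStarAlgAut_apply]
    rfl
  have hev : ∀ i, l i = 0 ∨ l i = 1 := by
    have hD : Wᴴ * P * W = diagonal (fun i => (l i : ℂ)) := by
      rw [hspec]
      simp only [Matrix.mul_assoc, hW1, Matrix.mul_one]
      rw [← Matrix.mul_assoc, hW1, Matrix.one_mul]
    have hWW : W * Wᴴ = 1 := mul_eq_one_comm.1 hW1
    have hDD : (Wᴴ * P * W) * (Wᴴ * P * W) = Wᴴ * P * W := by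
      calc _ = Wᴴ * (P * (W * Wᴴ) * P) * W := by simp only [Matrix.mul_assoc]
        _ = _ := by rw [hWW, Matrix.mul_one, hPP]
    rw [hD, diagonal_mul_diagonal, diagonal_eq_diagonal_iff] at hDD
    intro i
    have h2 : l i * l i = l i := by exact_mod_cast hDD i
    exact IsIdempotentElem.iff_eq_zero_or_one.1 h2
  let f := (Fintype.equivFin {i // l i = 1}).symm
  refine ⟨_, W.submatrix id (fun s => (f s : ι)), ?_, ?_⟩
  · rw [conjTranspose_submatrix, ← submatrix_mul _ _ _ _ _ Function.bijective_id, hW1]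
    ext s t
    simp [one_apply, ← Subtype.ext_iff]
  · rw [hspec]
    ext a b
    rw [mul_apply, mul_apply]
    refine Fintype.sum_of_injective (fun s => (f s : ι))
      (Subtype.val_injective.comp f.injective) _ _ (fun i hi => ?_) (fun s => ?_)
    · have : l i = 0 := (hev i).resolve_right fun h1 =>
        hi ⟨f.symm ⟨i, h1⟩, by simp⟩
      simp [mul_diagonal, this]
    · simp [mul_diagonal, (f s).2]

theorem Matrix.card_le_of_conjTranspose_mul_self {ι κ : Type*} [Fintype ι] [Fintype κ]
    [DecidableEq κ] {W : Matrix ι κ ℂ} (hW : Wᴴ * W = 1) : Fintype.card κ ≤ Fintype.card ι := by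
  have h1 := rank_mul_le_left Wᴴ W
  rw [hW, rank_one] at h1
  exact h1.trans Wᴴ.rank_le_card_width

theorem Matrix.exists_unitary_extension {ι κ : Type*} [Fintype ι] [DecidableEq ι] [Fintype κ]
    [DecidableEq κ] {W : Matrix ι κ ℂ} (hW : Wᴴ * W = 1) {e : κ → ι} (he : e.Injective) :
    ∃ U ∈ unitaryGroup ι ℂ, U.submatrix id e = W := by
  let w : κ → EuclideanSpace ℂ ι := fun x => WithLp.toLp 2 (W.col x)
  have hw : Orthonormal ℂ w := by
    rw [orthonormal_iff_ite]
    intro x y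
    rw [EuclideanSpace.inner_eq_star_dotProduct]
    have := congrFun (congrFun hW x) y
    rw [mul_apply, one_apply] at this
    rw [← this]
    simp [w, dotProduct, mul_comm]
  let v : ι → EuclideanSpace ℂ ι := Function.extend e w 0
  have hv : Orthonormal ℂ ((Set.range e).domRestrict v) := by
    have : (Set.range e).domRestrict v = w ∘ (Equiv.ofInjective e he).symm := by
      funext ⟨i, x, hx⟩
      subst hx
      simp [v, he.extend_apply, Set.domRestrict]
    rw [this]
    exact hw.comp _ (Equiv.injective _)
  obtain ⟨b, hb⟩ := hv.exists_orthonormalBasis_extension_of_card_eq (by simp)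
  refine ⟨(EuclideanSpace.basisFun ι ℂ).toBasis.toMatrix b,
    (EuclideanSpace.basisFun ι ℂ).toMatrix_orthonormalBasis_mem_unitary b, ?_⟩
  ext a x
  simp [Module.Basis.toMatrix_apply, hb (e x) ⟨x, rfl⟩, v, he.extend_apply, w]

theorem mul_diagPadAt_mul {p q N M r c k : ℕ} (A : Matrix (Fin p) (Fin q) ℂ)
    {f : Fin k × Fin p → Fin N} (hf : ∀ x, (f x : ℕ) = r + finProdFinEquiv x)
    {g : Fin k × Fin q → Fin M} (hg : ∀ y, (g y : ℕ) = c + finProdFinEquiv y)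
    {ι κ : Type*} (U : Matrix ι (Fin N) ℂ) (V : Matrix (Fin M) κ ℂ) :
    U * diagPadAt N M r c k A * V =
      U.submatrix id f * kroneckerMap (· * ·) (1 : Matrix (Fin k) (Fin k) ℂ) A *
        V.submatrix g id := by
  have hf_inj : f.Injective := fun x y h => finProdFinEquiv.injective <| by
    have := congrArg Fin.val h
    rw [hf, hf] at this
    exact Fin.ext (by omega)
  have hg_inj : g.Injective := fun x y h => finProdFinEquiv.injective <| by
    have := congrArg Fin.val h
    rw [hg, hg] at this
    exact Fin.ext (by omega)
  have hf_range : ∀ i, i ∉ Set.range f → ¬ (r ≤ (i : ℕ) ∧ (i : ℕ) - r < k * p) := by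
    rintro i hi ⟨h1, h2⟩
    exact hi ⟨finProdFinEquiv.symm ⟨i - r, h2⟩, Fin.ext (by simp [hf, Nat.mod_add_div, h1])⟩
  have hg_range : ∀ i, i ∉ Set.range g → ¬ (c ≤ (i : ℕ) ∧ (i : ℕ) - c < k * q) := by
    rintro i hi ⟨h1, h2⟩
    exact hi ⟨finProdFinEquiv.symm ⟨i - c, h2⟩, Fin.ext (by simp [hg, Nat.mod_add_div, h1])⟩
  have hD : ∀ x y, diagPadAt N M r c k A (f x) (g y) =
      kroneckerMap (· * ·) (1 : Matrix (Fin k) (Fin k) ℂ) A x y := by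
    rintro ⟨s, i⟩ ⟨t, j⟩
    have hp : 0 < p := i.pos
    have hq : 0 < q := j.pos
    have h1 : ((i : ℕ) + p * s) % p = i := by simp [Nat.mod_eq_of_lt]
    have h2 : ((i : ℕ) + p * s) / p = s := by
      rw [Nat.add_mul_div_left _ _ hp, Nat.div_eq_of_lt i.2, zero_add]
    have h3 : ((j : ℕ) + q * t) % q = j := by simp [Nat.mod_eq_of_lt]
    have h4 : ((j : ℕ) + q * t) / q = t := by
      rw [Nat.add_mul_div_left _ _ hq, Nat.div_eq_of_lt j.2, zero_add]
    have h5 := (finProdFinEquiv (s, i)).2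
    have h6 := (finProdFinEquiv (t, j)).2
    simp only [finProdFinEquiv_apply_val] at h5 h6
    simp only [diagPadAt, of_apply, hf, hg, finProdFinEquiv_apply_val, Nat.add_sub_cancel_left,
      h1, h2, h3, h4, kroneckerMap_apply, one_apply]
    rcases eq_or_ne s t with rfl | hst
    · simp [h5, h6]
    · simp [hst, Fin.val_inj]
  ext a b
  simp only [mul_apply]
  refine (Fintype.sum_of_injective g hg_inj _ _ (fun l hl => ?_) (fun y => ?_)).symm
  · refine mul_eq_zero_of_left (Finset.sum_eq_zero fun i _ => ?_) _
    have := hg_range l hl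
    rw [diagPadAt, of_apply, dif_neg (by tauto), mul_zero]
  · simp only [submatrix_apply, id_eq]
    congr 1
    refine Fintype.sum_of_injective f hf_inj _ _ (fun l hl => ?_) (fun x => ?_)
    · have := hf_range l hl
      rw [diagPadAt, of_apply, dif_neg (by tauto), mul_zero]
    · rw [hD]

theorem Matrix.conjTranspose_fromCols_mul_self {ι κ μ : Type*} [Fintype ι] [DecidableEq κ]
    [DecidableEq μ] {X : Matrix ι κ ℂ} {Y : Matrix ι μ ℂ} (hX : Xᴴ * X = 1) (hY : Yᴴ * Y = 1)
    (hXY : Xᴴ * Y = 0) : (fromCols X Y)ᴴ * fromCols X Y = 1 := by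
  have hYX : Yᴴ * X = 0 := by simpa using congrArg conjTranspose hXY
  rw [conjTranspose_fromCols_eq_fromRows_conjTranspose, fromRows_mul_fromCols, hX, hY, hXY, hYX,
    fromBlocks_one]

/-- The matrix whose columns are the columns of all the matrices `F i`. -/
def Matrix.gather {ι κ μ : Type*} (F : κ → Matrix ι μ ℂ) : Matrix ι (μ × κ) ℂ :=
  of fun a x => F x.2 a x.1

theorem Matrix.gather_apply {ι κ μ : Type*} (F : κ → Matrix ι μ ℂ) (a : ι) (x : μ × κ) :
    gather F a x = F x.2 a x.1 := rfl

theorem Matrix.conjTranspose_gather_mul_gather {ι κ μ ν : Type*} [Fintype ι]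
    (F : κ → Matrix ι μ ℂ) (G : ν → Matrix ι μ ℂ) (x : μ × κ) (y : μ × ν) :
    ((gather F)ᴴ * gather G) x y = ((F x.2)ᴴ * G y.2) x.1 y.1 := by
  simp [gather_apply, mul_apply]

theorem Matrix.conjTranspose_gather_mul_self {ι κ μ : Type*} [Fintype ι] [DecidableEq κ]
    [DecidableEq μ] {F : κ → Matrix ι μ ℂ}
    (hF : ∀ i j, (F i)ᴴ * F j = if i = j then 1 else 0) :
    (gather F)ᴴ * gather F = 1 := by
  ext x y
  rw [conjTranspose_gather_mul_gather, hF, one_apply]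
  split_ifs with h1 h2 h2
  · rw [h2, one_apply_eq]
  · rw [one_apply_ne fun h => h2 (Prod.ext h h1)]
  · exact absurd (congrArg Prod.snd h2) h1
  · rfl

theorem Matrix.gather_mul_kronecker_mul {ι κ μ ν : Type*} [Fintype κ] [Fintype μ] [Fintype ν]
    [DecidableEq μ] (F : κ → Matrix ι μ ℂ) (G : ν → Matrix ι μ ℂ) (A : Matrix κ ν ℂ) :
    gather F * kroneckerMap (· * ·) (1 : Matrix μ μ ℂ) A * (gather G)ᴴ =
      ∑ i, ∑ j, A i j • (F i * (G j)ᴴ) := by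
  ext a b
  simp only [gather_apply, mul_apply, kroneckerMap_apply, conjTranspose_apply, one_apply,
    Fintype.sum_prod_type, sum_apply, smul_apply, smul_eq_mul, ite_mul, one_mul, zero_mul, mul_ite,
    mul_zero, Finset.mul_sum]
  have : ∀ t j, (∑ s : μ, ∑ i : κ, (if s = t then F i a s * A i j else 0)) * star (G j b t) =
      ∑ i : κ, A i j * (F i a t * star (G j b t)) := by
    intro t j
    rw [Finset.sum_comm]
    simp [Finset.sum_mul, mul_assoc, mul_left_comm]
  simp only [this]
  rw [Finset.sum_comm]
  conv_rhs => rw [Finset.sum_comm]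
  exact Finset.sum_congr rfl fun j _ => Finset.sum_comm

/-- A sum of a product-preserving part with its transpose, given by orthonormal frames, is
unitarily equivalent to the padded block-diagonal form. -/
theorem exists_unitary_of_frames {m n N k : ℕ} (F : Fin m → Matrix (Fin N) (Fin k) ℂ)
    (G : Fin n → Matrix (Fin N) (Fin k) ℂ)
    (hF : ∀ i j, (F i)ᴴ * F j = if i = j then 1 else 0)
    (hG : ∀ i j, (G i)ᴴ * G j = if i = j then 1 else 0)
    (hFG : ∀ i j, (F i)ᴴ * (G j).map star = 0) :
    k * (m + n) ≤ N ∧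
      ∃ U ∈ unitaryGroup (Fin N) ℂ, ∃ V ∈ unitaryGroup (Fin N) ℂ,
        ∀ A : Matrix (Fin m) (Fin n) ℂ,
          ∑ i, ∑ j, A i j • (F i * (G j)ᴴ + (F i * (G j)ᴴ)ᵀ) =
            U * (diagPadAt N N 0 0 k A + diagPadAt N N (k * m) (k * n) k Aᵀ) * V := by
  have hconj : ∀ {X Y : Matrix (Fin N) (Fin k) ℂ}, (X.map star)ᴴ * Y.map star =
      (Xᴴ * Y).map star := by
    intro X Y
    ext
    simp [mul_apply]
  have hconj_frame : ∀ {l : ℕ} {H : Fin l → Matrix (Fin N) (Fin k) ℂ},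
      (∀ i j, (H i)ᴴ * H j = if i = j then 1 else 0) →
      ∀ i j, ((H i).map star)ᴴ * (H j).map star = if i = j then 1 else 0 := by
    intro l H hH i j
    rw [hconj, hH]
    split_ifs <;> ext <;> simp [one_apply, apply_ite]
  have hGF : ∀ j i, (G j)ᴴ * (F i).map star = 0 := by
    intro j i
    have := congrArg transpose (hFG i j)
    ext a b
    have := congrFun (congrFun this a) b
    simpa [mul_apply, mul_comm] using this
  have hXY : (gather F)ᴴ * gather (fun j => (G j).map star) = 0 := by
    ext x y
    rw [conjTranspose_gather_mul_gather, hFG]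
    rfl
  have hYX : (gather G)ᴴ * gather (fun j => (F j).map star) = 0 := by
    ext x y
    rw [conjTranspose_gather_mul_gather, hGF]
    rfl
  have hW := conjTranspose_fromCols_mul_self (conjTranspose_gather_mul_self hF)
    (conjTranspose_gather_mul_self (hconj_frame hG)) hXY
  have hW' := conjTranspose_fromCols_mul_self (conjTranspose_gather_mul_self hG)
    (conjTranspose_gather_mul_self (hconj_frame hF)) hYX
  have hcard : k * m + k * n ≤ N := by simpa using card_le_of_conjTranspose_mul_self hW
  have hcard' : k * n + k * m ≤ N := by omega
  let e : (Fin k × Fin m) ⊕ (Fin k × Fin n) → Fin N := fun x =>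
    Fin.castLE hcard (finSumFinEquiv (Sum.map finProdFinEquiv finProdFinEquiv x))
  let e' : (Fin k × Fin n) ⊕ (Fin k × Fin m) → Fin N := fun x =>
    Fin.castLE hcard' (finSumFinEquiv (Sum.map finProdFinEquiv finProdFinEquiv x))
  have he : e.Injective := (Fin.castLE_injective hcard).comp
    (finSumFinEquiv.injective.comp (finProdFinEquiv.injective.sumMap finProdFinEquiv.injective))
  have he' : e'.Injective := (Fin.castLE_injective hcard').comp
    (finSumFinEquiv.injective.comp (finProdFinEquiv.injective.sumMap finProdFinEquiv.injective))
  obtain ⟨U, hU, hUe⟩ := exists_unitary_extension hW he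
  obtain ⟨V, hV, hVe⟩ := exists_unitary_extension hW' he'
  refine ⟨by rwa [mul_add], U, hU, Vᴴ, Unitary.star_mem hV, fun A => ?_⟩
  have hU1 : U.submatrix id (fun x => e (Sum.inl x)) = gather F := by
    ext a x; exact congrFun (congrFun hUe a) (Sum.inl x)
  have hU2 : U.submatrix id (fun x => e (Sum.inr x)) = gather (fun j => (G j).map star) := by
    ext a x; exact congrFun (congrFun hUe a) (Sum.inr x)
  have hV1 : Vᴴ.submatrix (fun x => e' (Sum.inl x)) id = (gather G)ᴴ := by
    rw [← conjTranspose_submatrix]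
    congr 1
    ext a x; exact congrFun (congrFun hVe a) (Sum.inl x)
  have hV2 : Vᴴ.submatrix (fun x => e' (Sum.inr x)) id = (gather fun i => (F i).map star)ᴴ := by
    rw [← conjTranspose_submatrix]
    congr 1
    ext a x; exact congrFun (congrFun hVe a) (Sum.inr x)
  rw [Matrix.mul_add, Matrix.add_mul,
    mul_diagPadAt_mul A (f := fun x => e (Sum.inl x)) (g := fun x => e' (Sum.inl x))
      (fun x => by simp [e]) (fun x => by simp [e']),
    mul_diagPadAt_mul Aᵀ (f := fun x => e (Sum.inr x)) (g := fun x => e' (Sum.inr x))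
      (fun x => by simp [e]) (fun x => by simp [e']),
    hU1, hU2, hV1, hV2, gather_mul_kronecker_mul, gather_mul_kronecker_mul]
  simp only [smul_add, Finset.sum_add_distrib]
  congr 1
  rw [Finset.sum_comm]
  refine Finset.sum_congr rfl fun j _ => Finset.sum_congr rfl fun i _ => ?_
  rw [transpose_apply]
  congr 1
  ext a b
  simp [mul_apply, mul_comm]

theorem Matrix.single_mul_conjTranspose_single_mul_single {m n : ℕ} (i k p : Fin m)
    (j l q : Fin n) : (single i j (1 : ℂ) * (single k l (1 : ℂ))ᴴ * single p q (1 : ℂ)) =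
      if j = l ∧ k = p then single i q (1 : ℂ) else 0 := by
  rw [conjTranspose_single, star_one]
  rcases eq_or_ne j l with rfl | hjl
  · rcases eq_or_ne k p with rfl | hkp
    · simp
    · simp [hkp]
  · simp [hjl]

theorem transpose_rowPart {N : ℕ} {u v : Matrix (Fin N) (Fin N) ℂ} (hu : uᵀ = u) (hv : vᵀ = v) :
    (u * vᴴ * v)ᵀ = v * vᴴ * u := by
  have h : (vᴴ)ᵀ = vᴴ := by rw [conjTranspose, hv, ← transpose_map, hv]
  rw [transpose_mul, transpose_mul, hu, hv, h, Matrix.mul_assoc]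

/-- A grid of symmetric matrices is given by a pair of orthonormal frames. -/
theorem IsGrid.exists_frames {m n N : ℕ} (hm : 2 ≤ m) (hn : 2 ≤ n)
    {u : Fin m → Fin n → Matrix (Fin N) (Fin N) ℂ} (h : IsGrid u) (hu : ∀ i j, (u i j)ᵀ = u i j) :
    ∃ (k : ℕ) (F : Fin m → Matrix (Fin N) (Fin k) ℂ) (G : Fin n → Matrix (Fin N) (Fin k) ℂ),
      (∀ i j, (F i)ᴴ * F j = if i = j then 1 else 0) ∧
      (∀ i j, (G i)ᴴ * G j = if i = j then 1 else 0) ∧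
      (∀ i j, (F i)ᴴ * (G j).map star = 0) ∧
      ∀ i j, u i j = F i * (G j)ᴴ + (F i * (G j)ᴴ)ᵀ := by
  have : IsAddTorsionFree (Matrix (Fin N) (Fin N) ℂ) :=
    inferInstanceAs (IsAddTorsionFree (Fin N → Fin N → ℂ))
  have : Nontrivial (Fin n) := Fin.nontrivial_iff_two_le.2 hn
  let o : Fin m := ⟨0, by omega⟩
  let o' : Fin m := ⟨1, by omega⟩
  let z : Fin n := ⟨0, by omega⟩
  have ho : o ≠ o' := by simp [o, o']
  obtain ⟨k, E, hE, hEP⟩ := exists_isometry_of_projection (IsGrid.star_proj u o o' z)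
    (h.proj_mul_self ho z)
  have hEPE : Eᴴ * IsGrid.proj u o o' z * E = 1 := by
    rw [← hEP, ← Matrix.mul_assoc, hE, Matrix.one_mul, hE]
  refine ⟨k, fun i => IsGrid.colFactor u o o' z i * E, fun j => (IsGrid.rowFactor u o o' j)ᴴ * E,
    fun i j => ?_, fun i j => ?_, fun i j => ?_, fun i j => ?_⟩
  · rw [conjTranspose_mul, Matrix.mul_assoc, ← Matrix.mul_assoc _ _ E, ← star_eq_conjTranspose,
      h.star_colFactor_mul_colFactor ho, ← Matrix.mul_assoc]
    split_ifs
    · exact hEPE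
    · simp
  · rw [conjTranspose_mul, conjTranspose_conjTranspose, Matrix.mul_assoc, ← Matrix.mul_assoc _ _ E,
      ← star_eq_conjTranspose, h.rowFactor_mul_star_rowFactor ho z, ← Matrix.mul_assoc]
    split_ifs
    · exact hEPE
    · simp
  · have h1 : ((IsGrid.rowFactor u o o' j)ᴴ * E).map star =
        u o' j * star (u o' j) * u o j * E.map star := by
      rw [star_eq_conjTranspose, ← transpose_rowPart (hu o j) (hu o' j)]
      ext
      simp [mul_apply, IsGrid.rowFactor, star_eq_conjTranspose]
    rw [h1, conjTranspose_mul, Matrix.mul_assoc, ← Matrix.mul_assoc _ _ (E.map star),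
      ← star_eq_conjTranspose, h.star_colFactor_mul_col_part ho, Matrix.zero_mul, Matrix.mul_zero]
  · have h1 : IsGrid.colFactor u o o' z i * E * ((IsGrid.rowFactor u o o' j)ᴴ * E)ᴴ =
        IsGrid.colFactor u o o' z i * IsGrid.rowFactor u o o' j := by
      rw [conjTranspose_mul, conjTranspose_conjTranspose, Matrix.mul_assoc, ← Matrix.mul_assoc E,
        hEP, ← Matrix.mul_assoc, h.colFactor_mul_proj ho]
    obtain ⟨p, hp, h2⟩ := h.colFactor_mul_rowFactor ho z i j
    rw [h1, h2, star_eq_conjTranspose, transpose_rowPart (hu i j) (hu p j), add_comm]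
    exact (h.col_collinear hp j).symm

/-- a triple morphism from rectangular `m × n` matrices to symmetric
`N × N` matrices is, up to unitaries, of the form `A ↦ (diag_k(A) ⊕ diag_k(Aᵀ)) ⊕ 0`. -/
theorem triple_morphism_rectangular_to_symm (m n N : ℕ) (hm : 2 ≤ m) (hn : 2 ≤ n)
    (φ : Matrix (Fin m) (Fin n) ℂ →ₗ[ℂ] symmSub N)
    (hφ : ∀ x y z : Matrix (Fin m) (Fin n) ℂ,
      (φ ((1/2 : ℂ) • (x * yᴴ * z + z * yᴴ * x)) : Matrix (Fin N) (Fin N) ℂ) =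
        (1/2 : ℂ) • ((φ x : Matrix (Fin N) (Fin N) ℂ) * (φ y : Matrix (Fin N) (Fin N) ℂ)ᴴ *
            (φ z : Matrix (Fin N) (Fin N) ℂ) +
          (φ z : Matrix (Fin N) (Fin N) ℂ) * (φ y : Matrix (Fin N) (Fin N) ℂ)ᴴ *
            (φ x : Matrix (Fin N) (Fin N) ℂ))) :
    ∃ k : ℕ, k * (m + n) ≤ N ∧
      ∃ U ∈ Matrix.unitaryGroup (Fin N) ℂ, ∃ V ∈ Matrix.unitaryGroup (Fin N) ℂ,
        ∀ A : Matrix (Fin m) (Fin n) ℂ,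
          (φ A : Matrix (Fin N) (Fin N) ℂ) =
            U * (diagPadAt N N 0 0 k A + diagPadAt N N (k * m) (k * n) k Aᵀ) * V := by
  let u : Fin m → Fin n → Matrix (Fin N) (Fin N) ℂ := fun i j => φ (single i j 1)
  have hgrid : IsGrid u := ⟨fun i j k l p q => by
    have := hφ (single i j 1) (single k l 1) (single p q 1)
    rw [single_mul_conjTranspose_single_mul_single, single_mul_conjTranspose_single_mul_single,
      map_smul, Submodule.coe_smul, map_add, Submodule.coe_add] at this
    have := smul_right_injective _ (by norm_num : (1 / 2 : ℂ) ≠ 0) this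
    simp only [u, star_eq_conjTranspose]
    rw [← this]
    congr 1 <;> split_ifs <;> simp⟩
  have hφA : ∀ A, (φ A : Matrix (Fin N) (Fin N) ℂ) = ∑ i, ∑ j, A i j • u i j := by
    intro A
    conv_lhs => rw [matrix_eq_sum_single A]
    simp only [map_sum, Submodule.coe_sum, u]
    refine Finset.sum_congr rfl fun i _ => Finset.sum_congr rfl fun j _ => ?_
    rw [← Submodule.coe_smul, ← map_smul, smul_single, smul_eq_mul, mul_one]
  obtain ⟨k, F, G, hF, hG, hFG, huFG⟩ := hgrid.exists_frames hm hn fun i j => (φ _).2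
  obtain ⟨hk, U, hU, V, hV, hUV⟩ := exists_unitary_of_frames F G hF hG hFG
  refine ⟨k, hk, U, hU, V, hV, fun A => ?_⟩
  rw [hφA, ← hUV]
  simp only [huFG]
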